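/- arXiv:1607.05675 — 2 statements merged into one kernel-verified Lean document; each statement's English description precedes it below -/
import Mathlib

section
/- Let k ≥ 3, let a, b be distinct non-negative integers and a₁, …, a_{k−1} positive integers, and let f = f_{(a,b),(a₁,…,a_{k−1})} be the associated standard multiset on 𝔽₂^{k−1}. Then the Fourier transform of f is supported on {0, e₁, …, e_{k−1}, h} and is given by: f̂(0) = 2^{k−2}(a + b + ∑ᵢ aᵢ); f̂(eᵢ) = −2^{k−2} aᵢ for each 1 ≤ i ≤ k−1; f̂(h) = 2^{k−2}(a − b); and f̂(x) = 0 for all other x ∈ 𝔽₂^{k−1}. -/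
open Finset

/-- The character pairing `⟨x,y⟩ = (−1)^(x₁y₁+⋯+x_ny_n) ∈ ℤ` on `𝔽₂^n`. -/
def chr {n : ℕ} (x y : Fin n → ZMod 2) : ℤ :=
  (-1 : ℤ) ^ (∑ i, x i * y i).val

/-- The Fourier transform of a multiset `φ : 𝔽₂^n → ℕ`, viewed as taking values in `ℤ`. -/
def ftN {n : ℕ} (φ : (Fin n → ZMod 2) → ℕ) : (Fin n → ZMod 2) → ℤ :=
  fun x => ∑ y, (φ y : ℤ) * chr x y

/-- The standard multiset `f_{(a,b),(a₁,…,a_m)} : 𝔽₂^m → ℕ`, taking value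
`a + ∑ aᵢxᵢ` when `∑ xᵢ` is even and `b + ∑ aᵢxᵢ` when `∑ xᵢ` is odd. -/
def stdM {m : ℕ} (a b : ℕ) (c : Fin m → ℕ) : (Fin m → ZMod 2) → ℕ :=
  fun x => (if (∑ i, x i) = 0 then a else b) + ∑ i, c i * (x i).val

theorem neg_one_pow_val_add (s t : ZMod 2) :
    (-1 : ℤ) ^ (s + t).val = (-1) ^ s.val * (-1) ^ t.val := by
  revert s t; decide

theorem neg_one_pow_val_sum {ι : Type*} (s : Finset ι) (f : ι → ZMod 2) :
    (-1 : ℤ) ^ (∑ i ∈ s, f i).val = ∏ i ∈ s, (-1 : ℤ) ^ (f i).val := by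
  classical
  induction s using Finset.induction_on with
  | empty => simp
  | insert i s hi ih => rw [sum_insert hi, prod_insert hi, neg_one_pow_val_add, ih]

theorem chr_add_left {n : ℕ} (x z y : Fin n → ZMod 2) :
    chr (x + z) y = chr x y * chr z y := by
  simp only [chr, Pi.add_apply, add_mul, sum_add_distrib, neg_one_pow_val_add]

theorem sum_chr {n : ℕ} (x : Fin n → ZMod 2) :
    ∑ y, chr x y = if x = 0 then 2 ^ n else 0 := by
  have key : ∀ t : ZMod 2, ∑ j : ZMod 2, (-1 : ℤ) ^ (t * j).val = if t = 0 then 2 else 0 := by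
    decide
  simp only [chr, neg_one_pow_val_sum]
  rw [← Fintype.prod_sum (fun i (j : ZMod 2) => (-1 : ℤ) ^ (x i * j).val)]
  simp only [key]
  split_ifs with h
  · simp [h]
  · obtain ⟨i, hi⟩ := Function.ne_iff.mp h
    exact prod_eq_zero (mem_univ i) (if_neg hi)

/-- Orthogonality of the characters of `𝔽₂^n`. -/
theorem sum_chr_mul_chr {n : ℕ} (x z : Fin n → ZMod 2) :
    ∑ y, chr z y * chr x y = if x = z then 2 ^ n else 0 := by
  have h : z + x = z - x := funext fun i => (CharTwo.sub_eq_add (z i) (x i)).symm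
  simp only [← chr_add_left, sum_chr, h, sub_eq_zero, eq_comm]

/-- The expansion of a standard multiset in characters. -/
theorem two_mul_stdM {m : ℕ} (a b : ℕ) (c : Fin m → ℕ) (y : Fin m → ZMod 2) :
    2 * (stdM a b c y : ℤ) = (a + b + ∑ i, (c i : ℤ)) * chr 0 y
      + (a - b) * chr (fun _ => 1) y - ∑ i, (c i : ℤ) * chr (Pi.single i 1) y := by
  have hval : ∀ t : ZMod 2, 2 * (t.val : ℤ) = 1 - (-1) ^ t.val := by decide
  have hone : ∀ t : ZMod 2, t ≠ 0 → (-1 : ℤ) ^ t.val = -1 := by decide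
  have hsum : 2 * ∑ i, (c i : ℤ) * ((y i).val : ℤ)
      = ∑ i, (c i : ℤ) - ∑ i, (c i : ℤ) * (-1) ^ (y i).val := by
    rw [mul_sum, ← sum_sub_distrib]
    refine sum_congr rfl fun i _ => ?_
    linear_combination (c i : ℤ) * hval (y i)
  have hsingle : ∀ i, chr (Pi.single i 1) y = (-1) ^ (y i).val := fun i => by
    simp [chr, Pi.single_apply]
  have hzero : chr 0 y = 1 := by simp [chr]
  have hh : chr (fun _ => 1) y = (-1) ^ (∑ i, y i).val := by simp [chr]
  simp only [hsingle, hzero, hh, stdM]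
  push_cast
  rw [mul_add, hsum]
  split_ifs with h
  · rw [h, ZMod.val_zero]
    ring
  · rw [hone _ h]
    ring

theorem two_mul_ftN_stdM {m : ℕ} (a b : ℕ) (c : Fin m → ℕ) (x : Fin m → ZMod 2) :
    2 * ftN (stdM a b c) x = 2 ^ m * ((if x = 0 then (a + b + ∑ i, (c i : ℤ)) else 0)
      + (if x = (fun _ => 1) then (a - b : ℤ) else 0)
      - ∑ i, if x = Pi.single i 1 then (c i : ℤ) else 0) := by
  simp only [ftN, mul_sum (s := univ (α := Fin m → ZMod 2)), ← mul_assoc, two_mul_stdM]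
  generalize (a + b + ∑ i, (c i : ℤ)) = A
  generalize (a - b : ℤ) = B
  simp only [sub_mul, add_mul, sum_sub_distrib, sum_add_distrib, sum_mul]
  rw [sum_comm (s := univ (α := Fin m → ZMod 2))]
  simp only [mul_assoc, ← mul_sum, sum_chr_mul_chr]
  simp only [mul_sub, mul_add, mul_sum, mul_ite, mul_zero, zero_mul, mul_comm]

/-- For `k ≥ 3`, distinct non-negative integers `a ≠ b` and positive integers
`a₁,…,a_{k-1}`, the Fourier transform of `f = f_{(a,b),(a₁,…,a_{k-1})}` satisfies
`f̂(0) = 2^(k-2)(a+b+∑aᵢ)`, `f̂(eᵢ) = −2^(k-2)aᵢ`, `f̂(h) = 2^(k-2)(a−b)` where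
`h = e₁+⋯+e_{k-1}`, and `f̂(x) = 0` for all other `x`. -/
theorem stmt10 (k : ℕ) (hk : 3 ≤ k) (a b : ℕ) (hab : a ≠ b)
    (c : Fin (k - 1) → ℕ) (hc : ∀ i, 0 < c i) :
    ftN (stdM a b c) 0 = 2 ^ (k - 2) * ((a : ℤ) + b + ∑ i, (c i : ℤ)) ∧
    (∀ i : Fin (k - 1), ftN (stdM a b c) (Pi.single i 1) = -(2 ^ (k - 2)) * (c i : ℤ)) ∧
    ftN (stdM a b c) (fun _ => 1) = 2 ^ (k - 2) * ((a : ℤ) - (b : ℤ)) ∧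
    (∀ x : Fin (k - 1) → ZMod 2, x ≠ 0 → (∀ i, x ≠ Pi.single i 1) →
      x ≠ (fun _ => 1) → ftN (stdM a b c) x = 0) := by
  obtain ⟨n, rfl⟩ : ∃ n, k = n + 3 := ⟨k - 3, by omega⟩
  change Fin (n + 2) → ℕ at c
  change ftN (stdM a b c) 0 = 2 ^ (n + 1) * ((a : ℤ) + b + ∑ i, (c i : ℤ)) ∧
    (∀ i : Fin (n + 2), ftN (stdM a b c) (Pi.single i 1) = -(2 ^ (n + 1)) * (c i : ℤ)) ∧
    ftN (stdM a b c) (fun _ => 1) = 2 ^ (n + 1) * ((a : ℤ) - (b : ℤ)) ∧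
    (∀ x : Fin (n + 2) → ZMod 2, x ≠ 0 → (∀ i, x ≠ Pi.single i 1) →
      x ≠ (fun _ => 1) → ftN (stdM a b c) x = 0)
  have single_ne_zero : ∀ i : Fin (n + 2), (Pi.single i 1 : Fin (n + 2) → ZMod 2) ≠ 0 :=
    fun i => by simp
  have one_ne_zero' : (fun _ => 1 : Fin (n + 2) → ZMod 2) ≠ 0 :=
    fun h => one_ne_zero (congrFun h 0)
  have single_ne_one : ∀ i : Fin (n + 2),
      (Pi.single i 1 : Fin (n + 2) → ZMod 2) ≠ fun _ => 1 := fun i h => by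
    obtain ⟨j, hj⟩ := exists_ne i
    simpa [hj] using congrFun h j
  have single_inj : ∀ i j : Fin (n + 2),
      (Pi.single i 1 : Fin (n + 2) → ZMod 2) = Pi.single j 1 ↔ i = j := fun i j => by
    refine ⟨fun h => ?_, fun h => h ▸ rfl⟩
    by_contra hij
    simpa [hij] using congrFun h i
  refine ⟨?_, fun i => ?_, ?_, fun x h0 hs h1 => ?_⟩
  · have h := two_mul_ftN_stdM a b c 0
    simp only [one_ne_zero'.symm, (single_ne_zero _).symm, if_true, if_false,
      sum_const_zero] at h
    rw [pow_succ] at h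
    linarith
  · have h := two_mul_ftN_stdM a b c (Pi.single i 1)
    simp only [single_ne_zero, single_ne_one, single_inj, if_false, sum_ite_eq, mem_univ,
      if_true] at h
    rw [pow_succ] at h
    linarith
  · have h := two_mul_ftN_stdM a b c (fun _ => 1)
    simp only [one_ne_zero', (single_ne_one _).symm, if_true, if_false, sum_const_zero] at h
    rw [pow_succ] at h
    linarith
  · have h := two_mul_ftN_stdM a b c x
    simp only [h0, hs, h1, if_false, sum_const_zero] at h
    linarith
end

section
/- Let k ≥ 2 be an integer. If multisets f and g on 𝔽₂^{k−1} have distinguishing number k (i.e., they are (k−1)-indistinguishable but k-distinguishable), then some element of 𝔽₂^{k−1} appears with multiplicity at least k in f or in g; that is, there exists x ∈ 𝔽₂^{k−1} with f(x) ≥ k or g(x) ≥ k. -/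
open Finset

/-- The `k`-deck of a multiset `φ : G → ℕ`. -/
def deck {G : Type*} [Fintype G] [AddCommGroup G] (k : ℕ) (φ : G → ℕ) :
    (Fin k → G) → ℕ :=
  fun s => ∑ g : G, ∏ i, φ (g + s i)

/-- `φ` and `ψ` are `k`-indistinguishable if their `i`-decks agree for all `i ≤ k`. -/
def Indist {G : Type*} [Fintype G] [AddCommGroup G] (k : ℕ) (φ ψ : G → ℕ) : Prop :=
  ∀ i, i ≤ k → deck i φ = deck i ψ

/-- The nontrivial `±1`-valued character of `ZMod 2`. -/
def signChar (t : ZMod 2) : ℤ := if t = 0 then 1 else -1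

lemma signChar_add (s t : ZMod 2) : signChar (s + t) = signChar s * signChar t := by
  revert s t; decide

lemma signChar_zero : signChar 0 = 1 := rfl

lemma signChar_mul_self (t : ZMod 2) : signChar t * signChar t = 1 := by
  revert t; decide

lemma signChar_eq_one_or (t : ZMod 2) : signChar t = 1 ∨ signChar t = -1 := by
  revert t; decide

/-- The character of `𝔽₂^ι` attached to the vector `η`. -/
def walsh {ι : Type*} [Fintype ι] (η x : ι → ZMod 2) : ℤ := signChar (η ⬝ᵥ x)

/-- The Walsh–Fourier transform of `φ`. -/
def walshTransform {ι : Type*} [Fintype ι] [DecidableEq ι] (φ : (ι → ZMod 2) → ℕ)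
    (η : ι → ZMod 2) : ℤ := ∑ x, φ x * walsh η x

section Walsh

variable {ι : Type*} [Fintype ι]

lemma walsh_comm (η x : ι → ZMod 2) : walsh η x = walsh x η := by
  simp [walsh, dotProduct_comm]

lemma walsh_add_right (η x y : ι → ZMod 2) : walsh η (x + y) = walsh η x * walsh η y := by
  simp [walsh, dotProduct_add, signChar_add]

lemma walsh_zero_left (x : ι → ZMod 2) : walsh 0 x = 1 := by
  simp [walsh, signChar_zero]

lemma walsh_zero_right (η : ι → ZMod 2) : walsh η 0 = 1 := by
  simp [walsh, signChar_zero]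

lemma walsh_add_left (η ξ x : ι → ZMod 2) : walsh (η + ξ) x = walsh η x * walsh ξ x := by
  simp [walsh, add_dotProduct, signChar_add]

lemma walsh_mul_self (η x : ι → ZMod 2) : walsh η x * walsh η x = 1 := signChar_mul_self _

lemma walsh_eq_one_or (η x : ι → ZMod 2) : walsh η x = 1 ∨ walsh η x = -1 :=
  signChar_eq_one_or _

lemma walsh_sum_left {κ : Type*} (s : Finset κ) (η : κ → ι → ZMod 2) (x : ι → ZMod 2) :
    walsh (∑ i ∈ s, η i) x = ∏ i ∈ s, walsh (η i) x := by
  classical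
  induction s using Finset.induction_on with
  | empty => simp [walsh_zero_left]
  | insert a s ha ih => rw [sum_insert ha, prod_insert ha, walsh_add_left, ih]

variable [DecidableEq ι]

lemma sum_walsh_zero : ∑ x : ι → ZMod 2, walsh 0 x = 2 ^ Fintype.card ι := by
  simp [walsh_zero_left, ZMod.card]

lemma sum_walsh_of_ne_zero {η : ι → ZMod 2} (hη : η ≠ 0) : ∑ x, walsh η x = 0 := by
  obtain ⟨i, hi⟩ := Function.ne_iff.1 hη
  have h1 : η i = 1 := by
    have : ∀ t : ZMod 2, t ≠ 0 → t = 1 := by decide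
    exact this _ hi
  have h2 : walsh η (Pi.single i 1) = -1 := by
    rw [walsh, dotProduct_single, h1, mul_one]; rfl
  have h3 : ∑ x, walsh η x = ∑ x : ι → ZMod 2, walsh η (x + Pi.single i 1) := by
    rw [← Equiv.sum_comp (Equiv.addRight (Pi.single i (1 : ZMod 2))) (walsh η)]
    simp only [Equiv.coe_addRight]
  simp only [walsh_add_right, h2, ← sum_mul] at h3
  linarith

lemma sum_walsh (η : ι → ZMod 2) :
    ∑ x, walsh η x = if η = 0 then 2 ^ Fintype.card ι else 0 := by
  split_ifs with h
  · rw [h, sum_walsh_zero]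
  · exact sum_walsh_of_ne_zero h

lemma two_pow_mul_eq_sum_walshTransform (φ : (ι → ZMod 2) → ℕ) (x : ι → ZMod 2) :
    2 ^ Fintype.card ι * (φ x : ℤ) = ∑ η, walshTransform φ η * walsh η x := by
  simp only [walshTransform, sum_mul]
  rw [sum_comm]
  have h : ∀ y, ∑ η, (φ y : ℤ) * walsh η y * walsh η x
      = if y = x then 2 ^ Fintype.card ι * (φ y : ℤ) else 0 := by
    intro y
    have h1 : ∀ η, (φ y : ℤ) * walsh η y * walsh η x = φ y * walsh (y + x) η := by
      intro η
      rw [walsh_add_left, walsh_comm η, walsh_comm η, mul_assoc]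
    have h2 : y + x = 0 ↔ y = x := by
      rw [add_eq_zero_iff_eq_neg]
      have : -x = x := by ext i; exact ZModModule.neg_eq_self (x i)
      rw [this]
    simp only [h1, ← mul_sum, sum_walsh, h2]
    split_ifs <;> ring
  simp [h]

lemma sum_walsh_translate (φ : (ι → ZMod 2) → ℕ) (η g : ι → ZMod 2) :
    ∑ s, (φ (g + s) : ℤ) * walsh η s = walsh η g * walshTransform φ η := by
  rw [walshTransform, mul_sum,
    ← Equiv.sum_comp (Equiv.addLeft g) fun x => walsh η g * ((φ x : ℤ) * walsh η x)]
  refine sum_congr rfl fun s _ => ?_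
  simp only [Equiv.coe_addLeft, walsh_add_right]
  linear_combination (-(φ (g + s) : ℤ) * walsh η s) * walsh_mul_self η g

lemma sum_deck_mul_prod_walsh {m : ℕ} (φ : (ι → ZMod 2) → ℕ) (χ : Fin m → ι → ZMod 2)
    (hχ : ∑ i, χ i = 0) :
    ∑ s, (deck m φ s : ℤ) * ∏ i, walsh (χ i) (s i)
      = 2 ^ Fintype.card ι * ∏ i, walshTransform φ (χ i) := by
  simp only [deck, Nat.cast_sum, Nat.cast_prod, sum_mul, ← prod_mul_distrib]
  rw [sum_comm]
  have h : ∀ g : ι → ZMod 2,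
      ∑ s : Fin m → ι → ZMod 2, ∏ i, ((φ (g + s i) : ℤ) * walsh (χ i) (s i))
        = ∏ i, walshTransform φ (χ i) := by
    intro g
    rw [← Fintype.prod_sum fun i s => (φ (g + s) : ℤ) * walsh (χ i) s]
    simp only [sum_walsh_translate, prod_mul_distrib]
    rw [← walsh_sum_left, hχ, walsh_zero_left, one_mul]
  simp [h, ZMod.card]

lemma two_pow_mul_deck {m : ℕ} (φ : (ι → ZMod 2) → ℕ) (s : Fin m → ι → ZMod 2) :
    (2 ^ Fintype.card ι) ^ m * (deck m φ s : ℤ)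
      = ∑ χ : Fin m → ι → ZMod 2, (∏ i, walshTransform φ (χ i)) *
          ((∏ i, walsh (χ i) (s i)) * ∑ g, walsh (∑ i, χ i) g) := by
  simp only [deck, Nat.cast_sum, Nat.cast_prod, mul_sum]
  rw [sum_comm]
  refine sum_congr rfl fun g _ => ?_
  have h : (2 ^ Fintype.card ι : ℤ) ^ m = ∏ _i : Fin m, 2 ^ Fintype.card ι := by simp
  rw [h, ← prod_mul_distrib]
  simp only [two_pow_mul_eq_sum_walshTransform]
  rw [Fintype.prod_sum]
  refine sum_congr rfl fun χ _ => ?_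
  rw [walsh_sum_left, ← prod_mul_distrib, ← prod_mul_distrib]
  refine prod_congr rfl fun i _ => ?_
  rw [walsh_add_right]; ring

lemma deck_eq_of_prod_walshTransform_eq {m : ℕ} {φ ψ : (ι → ZMod 2) → ℕ}
    (h : ∀ χ : Fin m → ι → ZMod 2, ∑ i, χ i = 0 →
      ∏ i, walshTransform φ (χ i) = ∏ i, walshTransform ψ (χ i)) :
    deck m φ = deck m ψ := by
  funext s
  have h1 := two_pow_mul_deck φ s
  have h2 := two_pow_mul_deck ψ s
  have h3 : (2 ^ Fintype.card ι) ^ m * (deck m φ s : ℤ)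
      = (2 ^ Fintype.card ι) ^ m * (deck m ψ s : ℤ) := by
    rw [h1, h2]
    refine sum_congr rfl fun χ _ => ?_
    by_cases hχ : ∑ i, χ i = 0
    · rw [h χ hχ]
    · rw [sum_walsh_of_ne_zero hχ]; simp
  exact_mod_cast mul_left_cancel₀ (by positivity) h3

lemma prod_walshTransform_eq_of_indist {m : ℕ} {φ ψ : (ι → ZMod 2) → ℕ} (h : Indist m φ ψ)
    (M : Multiset (ι → ZMod 2)) (hcard : M.card ≤ m) (hsum : M.sum = 0) :
    (M.map (walshTransform φ)).prod = (M.map (walshTransform ψ)).prod := by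
  induction M using Quotient.inductionOn with
  | h l =>
    have hl : ∑ i : Fin l.length, l.get i = 0 := by
      rw [← List.sum_ofFn, List.ofFn_get]
      simpa using hsum
    have key := (sum_deck_mul_prod_walsh φ l.get hl).symm.trans
      ((congrArg (fun d : (Fin l.length → ι → ZMod 2) → ℕ =>
        ∑ s, (d s : ℤ) * ∏ i, walsh (l.get i) (s i)) (h _ hcard)).trans
        (sum_deck_mul_prod_walsh ψ l.get hl))
    have key' := mul_left_cancel₀ (by positivity) key
    have hconv : ∀ F : (ι → ZMod 2) → ℤ, (l.map F).prod = ∏ i, F (l.get i) := by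
      intro F
      rw [← List.prod_ofFn]
      congr 1
      conv_lhs => rw [← List.ofFn_get l, List.map_ofFn]
      rfl
    simpa only [Multiset.quot_mk_to_coe, Multiset.map_coe, Multiset.prod_coe, hconv] using key'

lemma prod_walshTransform_finset_eq_of_indist {κ : Type*} {m : ℕ} {φ ψ : (ι → ZMod 2) → ℕ}
    (h : Indist m φ ψ) (J : Finset κ) (χ : κ → ι → ZMod 2) (hcard : #J ≤ m)
    (hsum : ∑ j ∈ J, χ j = 0) :
    ∏ j ∈ J, walshTransform φ (χ j) = ∏ j ∈ J, walshTransform ψ (χ j) := by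
  have := prod_walshTransform_eq_of_indist h (J.val.map χ) (by simpa using hcard) hsum
  simpa only [Multiset.map_map, prod_eq_multiset_prod, Function.comp_def] using this

lemma mul_prod_walshTransform_eq_of_indist {κ : Type*} {m : ℕ} {φ ψ : (ι → ZMod 2) → ℕ}
    (h : Indist m φ ψ) (J : Finset κ) (χ : κ → ι → ZMod 2) (hcard : #J + 1 ≤ m)
    {η : ι → ZMod 2} (hsum : ∑ j ∈ J, χ j = η) :
    walshTransform φ η * ∏ j ∈ J, walshTransform φ (χ j)
      = walshTransform ψ η * ∏ j ∈ J, walshTransform ψ (χ j) := by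
  have := prod_walshTransform_eq_of_indist h (η ::ₘ J.val.map χ) (by simpa using hcard)
    (by
      rw [Multiset.sum_cons]
      change η + ∑ j ∈ J, χ j = 0
      rw [hsum]; exact ZModModule.add_self η)
  simpa only [Multiset.map_cons, Multiset.prod_cons, Multiset.map_map, prod_eq_multiset_prod,
    Function.comp_def] using this

lemma walshTransform_zero_eq_of_indist {m : ℕ} {φ ψ : (ι → ZMod 2) → ℕ} (h : Indist m φ ψ)
    (hm : 1 ≤ m) : walshTransform φ 0 = walshTransform ψ 0 := by
  simpa using prod_walshTransform_eq_of_indist h {0} (by simpa using hm) (by simp)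

lemma walshTransform_sq_eq_of_indist {m : ℕ} {φ ψ : (ι → ZMod 2) → ℕ} (h : Indist m φ ψ)
    (hm : 2 ≤ m) (η : ι → ZMod 2) : walshTransform φ η ^ 2 = walshTransform ψ η ^ 2 := by
  simpa [sq] using prod_walshTransform_eq_of_indist h {η, η} (by simpa using hm)
    (by simpa using ZModModule.add_self η)

end Walsh

section MinimalRelation

variable {n : ℕ} {χ : Fin (n + 1) → Fin n → ZMod 2}

lemma exists_sum_eq_of_minimal_relation
    (hmin : ∀ J : Finset (Fin (n + 1)), J.Nonempty → J ≠ univ → ∑ j ∈ J, χ j ≠ 0)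
    (η : Fin n → ZMod 2) :
    ∃ I : Finset (Fin n), ∑ i ∈ I, χ i.castSucc = η := by
  have hinj : Function.Injective fun I : Finset (Fin n) => ∑ i ∈ I, χ i.castSucc := by
    intro I I' h
    by_contra hne
    have hsymm : ∑ i ∈ symmDiff I I', χ i.castSucc = 0 := by
      have h1 : ∑ i ∈ symmDiff I I', χ i.castSucc
          = ∑ i ∈ I \ I', χ i.castSucc + ∑ i ∈ I' \ I, χ i.castSucc :=
        sum_union disjoint_sdiff_sdiff
      have h2 := sum_sdiff_sub_sum_sdiff (s₁ := I) (s₂ := I')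
        (f := fun i : Fin n => χ i.castSucc)
      simp only at h
      rw [h, sub_self] at h2
      rw [h1, sub_eq_zero.1 h2]
      exact ZModModule.add_self _
    refine hmin ((symmDiff I I').map Fin.castSuccEmb) ?_ ?_ ?_
    · rw [map_nonempty, nonempty_iff_ne_empty]
      intro h0
      exact hne (symmDiff_eq_bot.1 h0)
    · intro h0
      have : Fin.last n ∈ (symmDiff I I').map Fin.castSuccEmb := h0 ▸ mem_univ _
      obtain ⟨i, -, hi⟩ := mem_map.1 this
      exact (Fin.castSucc_lt_last i).ne hi
    · simpa using hsymm
  exact ((Fintype.bijective_iff_injective_and_card _).2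
    ⟨hinj, by simp [ZMod.card]⟩).surjective η

lemma exists_walsh_eq_of_minimal_relation
    (hmin : ∀ J : Finset (Fin (n + 1)), J.Nonempty → J ≠ univ → ∑ j ∈ J, χ j ≠ 0)
    (t : Fin n → ZMod 2) :
    ∃ x, ∀ i : Fin n, walsh (χ i.castSucc) x = signChar (t i) := by
  have hinj : Function.Injective fun (x : Fin n → ZMod 2) (i : Fin n) => χ i.castSucc ⬝ᵥ x := by
    intro x y h
    refine dotProduct_eq _ _ fun η => ?_
    obtain ⟨I, rfl⟩ := exists_sum_eq_of_minimal_relation hmin η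
    rw [dotProduct_sum, dotProduct_sum]
    refine sum_congr rfl fun i _ => ?_
    rw [dotProduct_comm x, dotProduct_comm y]
    exact congrFun h i
  obtain ⟨x, hx⟩ := Finite.injective_iff_surjective.1 hinj t
  exact ⟨x, fun i => congrArg signChar (congrFun hx i)⟩

lemma injective_option_elim_of_minimal_relation (hn : 2 ≤ n)
    (hmin : ∀ J : Finset (Fin (n + 1)), J.Nonempty → J ≠ univ → ∑ j ∈ J, χ j ≠ 0) :
    Function.Injective fun o : Option (Fin (n + 1)) => o.elim 0 χ := by
  have hlt : ∀ J : Finset (Fin (n + 1)), #J ≤ 2 → J ≠ univ := by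
    rintro J hJ rfl
    simp at hJ
    omega
  have h0 : ∀ j, χ j ≠ 0 := fun j => by
    simpa using hmin {j} (by simp) (hlt _ (by simp))
  rintro (_ | i) (_ | j) h
  · rfl
  · exact absurd h.symm (h0 j)
  · exact absurd h (h0 i)
  · by_contra hne
    have hij : i ≠ j := fun h => hne (congrArg some h)
    refine hmin {i, j} (by simp) (hlt _ card_le_two) ?_
    rw [sum_pair hij]
    change χ i = χ j at h
    rw [h]
    exact ZModModule.add_self _

end MinimalRelation

section Multiplicity

variable {n : ℕ} {f g : (Fin n → ZMod 2) → ℕ} {χ : Fin (n + 1) → Fin n → ZMod 2}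

lemma minimal_relation_of_indist (h : Indist n f g) (hsum : ∑ j, χ j = 0)
    (hprod : ∏ j, walshTransform f (χ j) ≠ ∏ j, walshTransform g (χ j))
    (J : Finset (Fin (n + 1))) (hne : J.Nonempty) (huniv : J ≠ univ) : ∑ j ∈ J, χ j ≠ 0 := by
  intro h0
  have hc : ∑ j ∈ Jᶜ, χ j = 0 := by
    have := sum_add_sum_compl J χ
    rwa [h0, hsum, zero_add] at this
  have hcard := card_add_card_compl J
  have h1 : 0 < #J := hne.card_pos
  have h2 : 0 < #Jᶜ := by
    rw [card_pos, nonempty_iff_ne_empty]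
    simpa using huniv
  rw [Fintype.card_fin] at hcard
  apply hprod
  rw [← prod_mul_prod_compl J, ← prod_mul_prod_compl J (fun j => walshTransform g (χ j)),
    prod_walshTransform_finset_eq_of_indist h J χ (by omega) h0,
    prod_walshTransform_finset_eq_of_indist h Jᶜ χ (by omega) hc]

lemma walshTransform_eq_zero_of_indist (hn : 2 ≤ n) (h : Indist n f g) (hsum : ∑ j, χ j = 0)
    (hprod : ∏ j, walshTransform f (χ j) ≠ ∏ j, walshTransform g (χ j))
    {η : Fin n → ZMod 2} (h0 : η ≠ 0) (hη : ∀ j, η ≠ χ j) : walshTransform f η = 0 := by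
  obtain ⟨I, hI⟩ :=
    exists_sum_eq_of_minimal_relation (minimal_relation_of_indist h hsum hprod) η
  set J : Finset (Fin (n + 1)) := I.map Fin.castSuccEmb with hJdef
  have hJ : ∑ j ∈ J, χ j = η := by simpa [hJdef] using hI
  have hJc : ∑ j ∈ Jᶜ, χ j = η := by
    have := sum_add_sum_compl J χ
    rw [hJ, hsum, add_eq_zero_iff_eq_neg] at this
    rw [this]
    exact (ZModModule.neg_eq_self _).symm
  have hcard : ∀ K : Finset (Fin (n + 1)), ∑ j ∈ K, χ j = η → 2 ≤ #K := by
    intro K hK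
    by_contra hlt
    obtain h' | h' : #K = 0 ∨ #K = 1 := by omega
    · rw [card_eq_zero.1 h', sum_empty] at hK
      exact h0 hK.symm
    · obtain ⟨j, rfl⟩ := card_eq_one.1 h'
      rw [sum_singleton] at hK
      exact hη j hK.symm
  have h1 := hcard J hJ
  have h2 := hcard Jᶜ hJc
  have h3 := card_add_card_compl J
  rw [Fintype.card_fin] at h3
  have e1 := mul_prod_walshTransform_eq_of_indist h J χ (by omega) hJ
  have e2 := mul_prod_walshTransform_eq_of_indist h Jᶜ χ (by omega) hJc
  have e3 := walshTransform_sq_eq_of_indist h hn η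
  by_contra hf
  apply hprod
  rw [← prod_mul_prod_compl J, ← prod_mul_prod_compl J (fun j => walshTransform g (χ j))]
  refine mul_left_cancel₀ (pow_ne_zero 2 hf) ?_
  nth_rewrite 2 [e3]
  linear_combination (walshTransform f η * ∏ j ∈ Jᶜ, walshTransform f (χ j)) * e1
    + (walshTransform g η * ∏ j ∈ J, walshTransform g (χ j)) * e2

lemma two_pow_mul_eq_of_indist (hn : 2 ≤ n) (h : Indist n f g) (hsum : ∑ j, χ j = 0)
    (hprod : ∏ j, walshTransform f (χ j) ≠ ∏ j, walshTransform g (χ j)) (x : Fin n → ZMod 2) :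
    2 ^ n * (f x : ℤ) = walshTransform f 0 + ∑ j, walshTransform f (χ j) * walsh (χ j) x := by
  have hinv := two_pow_mul_eq_sum_walshTransform f x
  rw [Fintype.card_fin] at hinv
  rw [hinv, ← Fintype.sum_of_injective (fun o : Option (Fin (n + 1)) => o.elim 0 χ)
    (injective_option_elim_of_minimal_relation hn (minimal_relation_of_indist h hsum hprod))
    (fun o => walshTransform f (o.elim 0 χ) * walsh (o.elim 0 χ) x) _ ?_ fun _ => rfl]
  · rw [Fintype.sum_option]
    simp [walsh_zero_left]
  · intro η hη
    rw [walshTransform_eq_zero_of_indist hn h hsum hprod, zero_mul]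
    · rintro rfl
      exact hη ⟨none, rfl⟩
    · rintro j rfl
      exact hη ⟨some j, rfl⟩

lemma exists_walshTransform_mul_walsh_eq (hn : 2 ≤ n) (h : Indist n f g) (hsum : ∑ j, χ j = 0)
    (hprod : ∏ j, walshTransform f (χ j) ≠ ∏ j, walshTransform g (χ j)) :
    ∃ a, (∀ i : Fin n, walshTransform g (χ i.castSucc) * walsh (χ i.castSucc) a
        = walshTransform f (χ i.castSucc)) ∧
      walshTransform g (χ (Fin.last n)) * walsh (χ (Fin.last n)) a
        = -walshTransform f (χ (Fin.last n)) := by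
  obtain ⟨a, ha⟩ := exists_walsh_eq_of_minimal_relation (minimal_relation_of_indist h hsum hprod)
    fun i => if walshTransform f (χ i.castSucc) = walshTransform g (χ i.castSucc) then 0 else 1
  have hsq := walshTransform_sq_eq_of_indist h hn
  have hcast : ∀ i : Fin n, walshTransform g (χ i.castSucc) * walsh (χ i.castSucc) a
      = walshTransform f (χ i.castSucc) := by
    intro i
    rw [ha i]
    split_ifs with hi
    · simp [hi, signChar]
    · rcases sq_eq_sq_iff_eq_or_eq_neg.1 (hsq (χ i.castSucc)) with h' | h'
      · exact absurd h' hi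
      · simp [h', signChar]
  refine ⟨a, hcast, ?_⟩
  have hlast : (walshTransform g (χ (Fin.last n)) * walsh (χ (Fin.last n)) a) ^ 2
      = walshTransform f (χ (Fin.last n)) ^ 2 := by
    rw [mul_pow, hsq, sq (walsh _ _), walsh_mul_self, mul_one]
  refine (sq_eq_sq_iff_eq_or_eq_neg.1 hlast).resolve_left fun heq => hprod ?_
  have hall : ∏ j, (walshTransform g (χ j) * walsh (χ j) a) = ∏ j, walshTransform f (χ j) := by
    rw [Fin.prod_univ_castSucc, Fin.prod_univ_castSucc, heq]
    simp only [hcast]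
  rw [← hall, prod_mul_distrib, ← walsh_sum_left, hsum, walsh_zero_left, mul_one]

lemma exists_le_of_indist_of_two_le (hn : 2 ≤ n) (h : Indist n f g) (hsum : ∑ j, χ j = 0)
    (hprod : ∏ j, walshTransform f (χ j) ≠ ∏ j, walshTransform g (χ j)) :
    ∃ x, n + 1 ≤ f x ∨ n + 1 ≤ g x := by
  have hsq := walshTransform_sq_eq_of_indist h hn
  have hne : ∀ j, walshTransform f (χ j) ≠ 0 := by
    intro j hj
    have hj' : walshTransform g (χ j) = 0 := by
      have := hsq (χ j)
      rw [hj] at this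
      simpa using this.symm
    exact hprod ((prod_eq_zero (mem_univ j) hj).trans (prod_eq_zero (mem_univ j) hj').symm)
  have hsurj := exists_walsh_eq_of_minimal_relation (minimal_relation_of_indist h hsum hprod)
  obtain ⟨a, ha, ha'⟩ := exists_walshTransform_mul_walsh_eq hn h hsum hprod
  set u := walshTransform f (χ (Fin.last n)) with hu
  set c : Fin n → ℤ := fun i => walshTransform f (χ i.castSucc) with hc
  have hf : ∀ x, 2 ^ n * (f x : ℤ) = walshTransform f 0
      + (∑ i, c i * walsh (χ i.castSucc) x + u * walsh (χ (Fin.last n)) x) := by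
    intro x
    rw [two_pow_mul_eq_of_indist hn h hsum hprod, Fin.sum_univ_castSucc]
  have hg : ∀ x, 2 ^ n * (g (x + a) : ℤ) = walshTransform f 0
      + (∑ i, c i * walsh (χ i.castSucc) x - u * walsh (χ (Fin.last n)) x) := by
    intro x
    rw [two_pow_mul_eq_of_indist hn (fun i hi => (h i hi).symm) hsum hprod.symm,
      Fin.sum_univ_castSucc, walshTransform_zero_eq_of_indist h (by omega)]
    congr 1
    have : ∀ i : Fin n, walshTransform g (χ i.castSucc) * walsh (χ i.castSucc) (x + a)
        = c i * walsh (χ i.castSucc) x := by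
      intro i
      simp only [walsh_add_right, hc, ← ha i]; ring
    simp only [this]
    rw [walsh_add_right]
    linear_combination walsh (χ (Fin.last n)) x * ha'
  have hudvd : (2 ^ n : ℤ) ∣ 2 * u := by
    refine ⟨f 0 - g (0 + a), ?_⟩
    rw [mul_sub, hf, hg, walsh_zero_right]; ring
  have hcdvd : ∀ i, (2 ^ n : ℤ) ∣ 2 * c i := by
    intro i
    obtain ⟨y, hy⟩ := hsurj (Pi.single i 1)
    have hlast : walsh (χ (Fin.last n)) y = -1 := by
      have h1 : walsh (∑ j, χ j) y = 1 := by rw [hsum, walsh_zero_left]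
      rw [walsh_sum_left, Fin.prod_univ_castSucc,
        prod_eq_single i (fun j _ hj => by rw [hy, Pi.single_eq_of_ne hj, signChar_zero])
          (by simp), hy, Pi.single_eq_same] at h1
      have h2 : signChar 1 = -1 := rfl
      rw [h2] at h1
      linarith
    have hdiff : ∑ j, c j * walsh (χ j.castSucc) 0 - ∑ j, c j * walsh (χ j.castSucc) y
        = 2 * c i := by
      rw [← sum_sub_distrib, sum_eq_single i]
      · rw [hy, Pi.single_eq_same, walsh_zero_right]
        have h2 : signChar 1 = -1 := rfl
        rw [h2]; ring
      · intro j _ hj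
        rw [hy, Pi.single_eq_of_ne hj, walsh_zero_right, signChar_zero]; ring
      · simp
    have : (2 ^ n : ℤ) ∣ 2 * c i + 2 * u := by
      refine ⟨f 0 - f y, ?_⟩
      rw [mul_sub, hf, hf, hlast, walsh_zero_right, ← hdiff]; ring
    exact (dvd_add_left hudvd).1 this
  have hule : (2 ^ n : ℤ) ≤ 2 * |u| := by
    have := Int.le_of_dvd (abs_pos.2 (mul_ne_zero two_ne_zero (hne (Fin.last n))))
      ((dvd_abs _ _).2 hudvd)
    simpa [abs_mul] using this
  have hcle : ∀ i, (2 ^ n : ℤ) ≤ 2 * |c i| := by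
    intro i
    have := Int.le_of_dvd (abs_pos.2 (mul_ne_zero two_ne_zero (hne i.castSucc)))
      ((dvd_abs _ _).2 (hcdvd i))
    simpa [abs_mul] using this
  have hsumle : (n : ℤ) * 2 ^ n ≤ 2 * ∑ i, |c i| := by
    rw [mul_sum]
    simpa using card_nsmul_le_sum univ (fun i => 2 * |c i|) _ fun i _ => hcle i
  obtain ⟨x, hx⟩ := hsurj fun i => if 0 ≤ c i then 0 else 1
  obtain ⟨y, hy⟩ := hsurj fun i => if 0 ≤ c i then 1 else 0
  have hxsum : ∑ i, c i * walsh (χ i.castSucc) x = ∑ i, |c i| := by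
    refine sum_congr rfl fun i _ => ?_
    rw [hx]
    split_ifs with hi
    · simp [signChar, abs_of_nonneg hi]
    · simp [signChar, abs_of_neg (not_le.1 hi)]
  have hysum : ∑ i, c i * walsh (χ i.castSucc) y = -∑ i, |c i| := by
    rw [← sum_neg_distrib]
    refine sum_congr rfl fun i _ => ?_
    rw [hy]
    split_ifs with hi
    · simp [signChar, abs_of_nonneg hi]
    · simp [signChar, abs_of_neg (not_le.1 hi)]
  have hymin : ∑ i, |c i| + |u| ≤ walshTransform f 0 := by
    have h1 := hf y
    have h2 := hg y
    have h3 : (0 : ℤ) ≤ 2 ^ n * f y := by positivity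
    have h4 : (0 : ℤ) ≤ 2 ^ n * g (y + a) := by positivity
    rw [hysum] at h1 h2
    rcases walsh_eq_one_or (χ (Fin.last n)) y with h' | h' <;> rw [h'] at h1 h2 <;>
      rcases abs_cases u with ⟨h'', -⟩ | ⟨h'', -⟩ <;> rw [h''] <;> linarith
  by_contra! hlt
  have hxmax : walshTransform f 0 + (∑ i, |c i| + |u|) ≤ 2 ^ n * n := by
    have h1 := hf x
    have h2 := hg x
    have h3 : (2 ^ n * f x : ℤ) ≤ 2 ^ n * n := by
      gcongr; exact Nat.lt_succ_iff.1 (hlt x).1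
    have h4 : (2 ^ n * g (x + a) : ℤ) ≤ 2 ^ n * n := by
      gcongr; exact Nat.lt_succ_iff.1 (hlt (x + a)).2
    rw [hxsum] at h1 h2
    rcases walsh_eq_one_or (χ (Fin.last n)) x with h' | h' <;> rw [h'] at h1 h2 <;>
      rcases abs_cases u with ⟨h'', -⟩ | ⟨h'', -⟩ <;> rw [h''] <;> linarith
  have hpos : (0 : ℤ) < 2 ^ n := by positivity
  linarith

end Multiplicity

lemma exists_two_le_of_indist_one {f g : (Fin 1 → ZMod 2) → ℕ} {χ : Fin 2 → Fin 1 → ZMod 2}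
    (h : Indist 1 f g) (hsum : ∑ j, χ j = 0)
    (hprod : ∏ j, walshTransform f (χ j) ≠ ∏ j, walshTransform g (χ j)) :
    ∃ x, 2 ≤ f x ∨ 2 ≤ g x := by
  by_contra! hlt
  apply hprod
  have huniv : (univ : Finset (Fin 1 → ZMod 2)) = {0, 1} := by decide
  have hχ : χ 1 = χ 0 := by
    rw [Fin.sum_univ_two, add_eq_zero_iff_eq_neg] at hsum
    rw [hsum]
    exact (ZModModule.neg_eq_self _).symm
  have hzero := walshTransform_zero_eq_of_indist h le_rfl
  rw [Fin.prod_univ_two, Fin.prod_univ_two, hχ]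
  have hT0 : ∀ φ : (Fin 1 → ZMod 2) → ℕ, walshTransform φ 0 = φ 0 + φ 1 := by
    intro φ
    rw [walshTransform, huniv, sum_pair (by decide)]
    simp [walsh_zero_left]
  have hT1 : ∀ φ : (Fin 1 → ZMod 2) → ℕ, walshTransform φ 1 = φ 0 - φ 1 := by
    intro φ
    rw [walshTransform, huniv, sum_pair (by decide)]
    simp [walsh, signChar, sub_eq_add_neg]
  have hmem : χ 0 ∈ ({0, 1} : Finset (Fin 1 → ZMod 2)) := huniv ▸ mem_univ _
  rw [mem_insert, mem_singleton] at hmem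
  rcases hmem with h0 | h1
  · rw [h0, hzero]
  · rw [hT0, hT0] at hzero
    rw [h1, hT1, hT1]
    have := hlt 0
    have := hlt 1
    obtain ⟨h2, h3⟩ | ⟨h2, h3⟩ :
        ((f 0 : ℤ) = g 0 ∧ (f 1 : ℤ) = g 1) ∨ ((f 0 : ℤ) = g 1 ∧ (f 1 : ℤ) = g 0) := by omega
    · rw [h2, h3]
    · rw [h2, h3]; ring

lemma exists_succ_le_of_indist {n : ℕ} (hn : 1 ≤ n) {f g : (Fin n → ZMod 2) → ℕ}
    (h : Indist n f g) (hdist : ¬ Indist (n + 1) f g) : ∃ x, n + 1 ≤ f x ∨ n + 1 ≤ g x := by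
  have hdeck : deck (n + 1) f ≠ deck (n + 1) g := by
    intro heq
    refine hdist fun i hi => ?_
    obtain h' | rfl := Nat.le_succ_iff.1 hi
    · exact h i h'
    · exact heq
  obtain ⟨χ, hsum, hprod⟩ : ∃ χ : Fin (n + 1) → Fin n → ZMod 2, ∑ i, χ i = 0 ∧
      ∏ i, walshTransform f (χ i) ≠ ∏ i, walshTransform g (χ i) := by
    by_contra! hall
    exact hdeck (deck_eq_of_prod_walshTransform_eq hall)
  obtain rfl | hn' := hn.eq_or_lt
  · exact exists_two_le_of_indist_one h hsum hprod
  · exact exists_le_of_indist_of_two_le hn' h hsum hprod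

/-- For `k ≥ 2`, if multisets `f` and `g` on `𝔽₂^(k-1)` have distinguishing number `k`
(i.e. they are `(k-1)`-indistinguishable but `k`-distinguishable), then some element of
`𝔽₂^(k-1)` appears with multiplicity at least `k` in `f` or in `g`. -/
theorem stmt14 (k : ℕ) (hk : 2 ≤ k) (f g : (Fin (k - 1) → ZMod 2) → ℕ)
    (hindist : Indist (k - 1) f g) (hdist : ¬ Indist k f g) :
    ∃ x : Fin (k - 1) → ZMod 2, k ≤ f x ∨ k ≤ g x := by
  obtain ⟨n, rfl⟩ : ∃ n, k = n + 1 := ⟨k - 1, by omega⟩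
  exact exists_succ_le_of_indist (n := n) (by omega) hindist hdist
end
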